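/- arXiv:2103.04575 — 2 statements merged into one kernel-verified Lean document; each statement's English description precedes it below -/
import Mathlib

section
/- Let K₁ and K₂ be fields. If the Laurent polynomial rings K₁[t,t⁻¹] and K₂[t,t⁻¹] are elementarily equivalent as rings, then the polynomial rings K₁[t] and K₂[t] are elementarily equivalent as rings. -/
open FirstOrder Language FirstOrder.Ring LaurentPolynomial Polynomial

namespace FirstOrder.Language

universe u v w w'
variable {L : Language.{u, v}}

/-- Relativization of a formula to the definable set cut out by `D`; the variable `false` of `D`
is a parameter and the variable `true` ranges over the set. -/
def BoundedFormula.relativize (D : L.Formula Bool) :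
    ∀ {n : ℕ}, L.BoundedFormula Empty n → L.BoundedFormula Unit n
  | _, .falsum => .falsum
  | _, .equal s t => .equal (s.relabel (Sum.map Empty.elim id)) (t.relabel (Sum.map Empty.elim id))
  | _, .rel R ts => .rel R fun i => (ts i).relabel (Sum.map Empty.elim id)
  | _, .imp φ ψ => .imp (relativize D φ) (relativize D ψ)
  | n, .all φ =>
    .all (.imp
      (BoundedFormula.relabel (n := n + 1) (k := 0)
        (fun b : Bool => if b then Sum.inr (Fin.last n) else Sum.inl ()) D)
      (relativize D φ))

theorem BoundedFormula.realize_relativize {M : Type w} {A : Type w'} [L.Structure M]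
    [L.Structure A] (D : L.Formula Bool) (u : M) (e : A ↪[L] M)
    (he : ∀ x, D.Realize (fun b => if b then x else u) ↔ x ∈ Set.range e) {n : ℕ}
    (φ : L.BoundedFormula Empty n) (xs : Fin n → A) :
    (relativize D φ).Realize (fun _ => u) (e ∘ xs) ↔ φ.Realize default xs := by
  have ht : ∀ {n : ℕ} (t : L.Term (Empty ⊕ Fin n)) (xs : Fin n → A),
      (t.relabel (Sum.map Empty.elim id)).realize (Sum.elim (fun _ : Unit => u) (e ∘ xs)) =
        e (t.realize (Sum.elim default xs)) := by
    intro n t xs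
    rw [Term.realize_relabel, ← HomClass.realize_term]
    congr 1
    funext i
    rcases i with i | i
    · exact i.elim
    · rfl
  induction φ with
  | falsum => rfl
  | equal s t => simp [relativize, BoundedFormula.Realize, ht]
  | rel R ts =>
    simp only [relativize, BoundedFormula.Realize, ht]
    exact e.map_rel R _
  | imp φ ψ ih₁ ih₂ => simp only [relativize, BoundedFormula.Realize, ih₁, ih₂]
  | @all n φ ih =>
    have hD : ∀ x : M, (BoundedFormula.relabel (n := n + 1) (k := 0)
        (fun b : Bool => if b then Sum.inr (Fin.last n) else Sum.inl ()) D).Realize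
          (fun _ => u) (Fin.snoc (e ∘ xs) x) ↔ x ∈ Set.range e := by
      intro x
      rw [BoundedFormula.realize_relabel, ← he, Formula.Realize]
      apply iff_of_eq
      congr 1
      · funext b
        cases b <;> simp
      · exact Subsingleton.elim _ _
    simp only [relativize, BoundedFormula.Realize]
    constructor
    · intro h a
      refine (ih _).1 ?_
      rw [Fin.comp_snoc]
      exact h (e a) ((hD _).2 ⟨a, rfl⟩)
    · intro h x hx
      obtain ⟨a, rfl⟩ := (hD x).1 hx
      rw [← Fin.comp_snoc]
      exact (ih _).2 (h a)

/-- `A` is interpreted in `M` as the set defined by `D`, for every parameter satisfying `P`. -/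
def IsInterpretedBy (A : Type w) (M : Type w') [L.Structure A] [L.Structure M]
    (P : L.Formula Unit) (D : L.Formula Bool) : Prop :=
  (∃ u : M, P.Realize fun _ => u) ∧
    ∀ u : M, P.Realize (fun _ => u) → ∃ e : A ↪[L] M,
      ∀ x, D.Realize (fun b => if b then x else u) ↔ x ∈ Set.range e

theorem IsInterpretedBy.realize_iff {A : Type w} {M : Type w'} [L.Structure A] [L.Structure M]
    {P : L.Formula Unit} {D : L.Formula Bool} (h : IsInterpretedBy A M P D) (φ : L.Sentence) :
    M ⊨ Formula.iExs Unit ((P ⊓ BoundedFormula.relativize D φ : L.Formula Unit).relabel Sum.inr :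
      L.Formula (Empty ⊕ Unit)) ↔ A ⊨ φ := by
  have key : ∀ u : M, P.Realize (fun _ => u) →
      (Formula.Realize (BoundedFormula.relativize D φ : L.Formula Unit) (fun _ => u) ↔ A ⊨ φ) := by
    intro u hu
    obtain ⟨e, he⟩ := h.2 u hu
    rw [Sentence.Realize, Formula.Realize, Formula.Realize,
      ← BoundedFormula.realize_relativize D u e he φ]
    apply iff_of_eq
    congr 1
    exact Subsingleton.elim _ _
  rw [Sentence.Realize, Formula.realize_iExs]
  simp only [Formula.realize_relabel, Sum.elim_comp_inr, Formula.realize_inf]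
  constructor
  · rintro ⟨i, hP, hφ⟩
    exact (key (i ()) hP).1 hφ
  · intro hφ
    obtain ⟨u, hu⟩ := h.1
    exact ⟨fun _ => u, hu, (key u hu).2 hφ⟩

theorem IsInterpretedBy.elementarilyEquivalent {A B M N : Type*} [L.Structure A] [L.Structure B]
    [L.Structure M] [L.Structure N] {P : L.Formula Unit} {D : L.Formula Bool}
    (hA : IsInterpretedBy A M P D) (hB : IsInterpretedBy B N P D) (h : M ≅[L] N) :
    A ≅[L] B :=
  elementarilyEquivalent_iff.2 fun φ => by
    rw [← hA.realize_iff, ← hB.realize_iff, elementarilyEquivalent_iff.1 h]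

theorem ElementarilyEquivalent.natCard_eq {M N : Type*} [L.Structure M] [L.Structure N]
    [Finite M] (h : M ≅[L] N) : Finite N ∧ Nat.card M = Nat.card N := by
  have key : ∀ n : ℕ, (n : Cardinal) ≤ Cardinal.mk M ↔ (n : Cardinal) ≤ Cardinal.mk N := by
    intro n
    rw [← Sentence.realize_cardGe (L := L), ← Sentence.realize_cardGe (L := L),
      elementarilyEquivalent_iff.1 h]
  have hN : Finite N := by
    by_contra hN
    rw [not_finite_iff_infinite] at hN
    have := (key (Nat.card M + 1)).2 ((Cardinal.natCast_le_aleph0).trans (Cardinal.aleph0_le_mk N))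
    rw [← Nat.cast_card] at this
    have := Nat.cast_le.1 this
    omega
  refine ⟨hN, le_antisymm ?_ ?_⟩
  · have := (key (Nat.card M)).1 Nat.cast_card.le
    rwa [← Nat.cast_card, Nat.cast_le] at this
  · have := (key (Nat.card N)).2 Nat.cast_card.le
    rwa [← Nat.cast_card, Nat.cast_le] at this

end FirstOrder.Language

namespace LaurentPolynomial

variable {K : Type*} [Field K]

theorem C_injective : Function.Injective (C : K → K[T;T⁻¹]) := fun a b h =>
  Polynomial.C_injective (toLaurent_injective (by rwa [toLaurent_C, toLaurent_C]))

theorem isUnit_iff {f : K[T;T⁻¹]} : IsUnit f ↔ ∃ a : K, a ≠ 0 ∧ ∃ n : ℤ, f = C a * T n := by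
  constructor
  · intro h
    obtain ⟨g, hg⟩ := h.exists_right_inv
    obtain ⟨n, F, hF⟩ := exists_T_pow f
    obtain ⟨m, G, hG⟩ := exists_T_pow g
    have hFG : F * G = X ^ (n + m) := by
      apply toLaurent_injective
      rw [map_mul, hF, hG, toLaurent_X_pow, Nat.cast_add, T_add, mul_mul_mul_comm, hg, one_mul]
    obtain ⟨i, -, hi⟩ := (dvd_prime_pow prime_X _).1 (Dvd.intro _ hFG)
    obtain ⟨v, hv⟩ := hi.symm
    obtain ⟨a, ha, hav⟩ := Polynomial.isUnit_iff.1 v.isUnit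
    refine ⟨a, ha.ne_zero, i - n, ?_⟩
    calc f = toLaurent F * T (-n) := by rw [hF, mul_T_assoc, add_neg_cancel, T_zero, mul_one]
      _ = C a * T (i - n) := by
        rw [← hv, ← hav, map_mul, toLaurent_X_pow, toLaurent_C, mul_comm, T_sub]; ring
  · rintro ⟨a, ha, n, rfl⟩
    exact ((isUnit_iff_ne_zero.2 ha).map C).mul (isUnit_T n)

/-- The ring-theoretic description of the constants: zero, minus one, and the `x` such that `x` and
`x + 1` are units. -/
theorem exists_eq_C_iff {x : K[T;T⁻¹]} :
    (∃ a, x = C a) ↔ x = 0 ∨ x + 1 = 0 ∨ IsUnit x ∧ IsUnit (x + 1) := by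
  constructor
  · rintro ⟨a, rfl⟩
    by_cases h0 : a = 0
    · simp [h0]
    by_cases h1 : a + 1 = 0
    · right; left; rw [← map_one C, ← map_add, h1, map_zero]
    · right; right
      rw [← map_one C, ← map_add]
      exact ⟨(isUnit_iff_ne_zero.2 h0).map C, (isUnit_iff_ne_zero.2 h1).map C⟩
  · rintro (rfl | h | ⟨h, h'⟩)
    · exact ⟨0, by simp⟩
    · exact ⟨-1, by simp [eq_neg_of_add_eq_zero_left h]⟩
    · obtain ⟨a, ha, n, rfl⟩ := isUnit_iff.1 h
      obtain ⟨b, hb, m, hbm⟩ := isUnit_iff.1 h'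
      by_cases hn : n = 0
      · exact ⟨a, by simp [hn]⟩
      exfalso
      rw [← T_zero, ← one_mul (T 0), ← map_one C, ← single_eq_C_mul_T, ← single_eq_C_mul_T,
        ← single_eq_C_mul_T] at hbm
      have h1 := congrArg (fun f => f.coeff n) hbm
      have h2 := congrArg (fun f => f.coeff 0) hbm
      simp only [AddMonoidAlgebra.coeff_add, Finsupp.add_apply, AddMonoidAlgebra.coeff_single,
        Finsupp.single_apply, if_true, hn, Ne.symm hn, if_false, add_zero, zero_add] at h1 h2
      by_cases hm : m = 0
      · simp [hm, Ne.symm hn, ha] at h1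
      · simp [hm] at h2

/-- Nonconstant units `u` for which every element is constant modulo `u - 1`. -/
def IsUniformizer (u : K[T;T⁻¹]) : Prop :=
  IsUnit u ∧ (¬ ∃ a, u = C a) ∧ ∀ x : K[T;T⁻¹], ∃ a : K, u + -1 ∣ x + -C a

theorem isUniformizer_T : IsUniformizer (T 1 : K[T;T⁻¹]) := by
  refine ⟨isUnit_T 1, ?_, fun x => ?_⟩
  · rintro ⟨a, ha⟩
    have := congrArg (fun f => f.coeff 1) ha
    simp at this
  · obtain ⟨n, F, hF⟩ := exists_T_pow x
    refine ⟨F.eval 1, ?_⟩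
    have h1 : (T 1 : K[T;T⁻¹]) + -1 ∣ x * T n + -C (F.eval 1) := by
      rw [← hF, ← toLaurent_C, ← toLaurent_X, ← map_one toLaurent, ← sub_eq_add_neg,
        ← sub_eq_add_neg, ← map_sub, ← map_sub]
      exact map_dvd _ (by simpa using X_sub_C_dvd_sub_C_eval (a := (1 : K)) (p := F))
    have h2 : (T 1 : K[T;T⁻¹]) + -1 ∣ T n - 1 := by
      have := sub_one_dvd_pow_sub_one (T 1 : K[T;T⁻¹]) n
      simpa [T_pow, sub_eq_add_neg] using this
    have h3 := dvd_sub h1 (h2.mul_left x)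
    ring_nf at h3 ⊢
    exact h3

theorem IsUniformizer.exists_eq {u : K[T;T⁻¹]} (hu : IsUniformizer u) :
    ∃ a : K, a ≠ 0 ∧ (u = C a * T 1 ∨ u = C a * T (-1)) := by
  obtain ⟨hu, hc, hd⟩ := hu
  obtain ⟨a, ha, n, rfl⟩ := isUnit_iff.1 hu
  refine ⟨a, ha, ?_⟩
  obtain ⟨b, hb⟩ := hd (T 1)
  have key : ∀ (c : K) (k : ℕ), c ≠ 0 → C c * T k + -1 ∣ T 1 + -C b → k ≤ 1 := by
    rintro c k hc ⟨g, hg⟩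
    by_contra! hk
    obtain ⟨m, G, hG⟩ := exists_T_pow g
    have h1 : X ^ m * (X - Polynomial.C b) = (Polynomial.C c * X ^ k - 1) * G := by
      apply toLaurent_injective
      simp only [map_mul, map_sub, toLaurent_X_pow, toLaurent_X, toLaurent_C, hG, map_one]
      linear_combination T (m : ℤ) * hg
    have h2 : IsCoprime (Polynomial.C c * X ^ k - 1) (X ^ m : K[X]) := by
      apply IsCoprime.pow_right
      refine ⟨-1, Polynomial.C c * X ^ (k - 1), ?_⟩
      rw [mul_assoc, ← pow_succ, Nat.sub_add_cancel (by omega)]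
      ring
    have h3 := natDegree_le_of_dvd (h2.dvd_of_dvd_mul_left (Dvd.intro _ h1.symm)) (X_sub_C_ne_zero b)
    rw [natDegree_X_sub_C, ← map_one Polynomial.C, natDegree_sub_C,
      natDegree_C_mul_X_pow _ _ hc] at h3
    omega
  obtain ⟨k, rfl | rfl⟩ := n.eq_nat_or_neg
  · have := key a k ha hb
    interval_cases k
    · exact (hc ⟨a, by simp⟩).elim
    · exact Or.inl rfl
  · have := key a⁻¹ k (inv_ne_zero ha) (by
      refine Dvd.dvd.trans ⟨-(C a * T (-k)), ?_⟩ hb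
      have h1 : C a⁻¹ * C a = (1 : K[T;T⁻¹]) := by rw [← map_mul, inv_mul_cancel₀ ha, map_one]
      have h2 : T (k : ℤ) * T (-k : ℤ) = (1 : K[T;T⁻¹]) := by rw [← T_add, add_neg_cancel, T_zero]
      linear_combination (T (k : ℤ) * T (-k : ℤ)) * h1 + h2)
    interval_cases k
    · exact (hc ⟨a, by simp⟩).elim
    · exact Or.inr rfl

theorem IsUniformizer.exists_eval {u : K[T;T⁻¹]} (hu : IsUniformizer u) {d : K} (hd : d ≠ 0) :
    ∃ ev : K[T;T⁻¹] →+* K, ev u = d ∧ ∀ a, ev (C a) = a := by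
  obtain ⟨a, ha, rfl | rfl⟩ := hu.exists_eq
  · refine ⟨eval₂ (RingHom.id K) (Units.mk0 (d / a) (div_ne_zero hd ha)), ?_, fun a => by simp⟩
    rw [eval₂_C_mul_T]
    simp
    field_simp
  · refine ⟨eval₂ (RingHom.id K) (Units.mk0 (a / d) (div_ne_zero ha hd)), ?_, fun a => by simp⟩
    rw [eval₂_C_mul_T]
    simp
    field_simp

theorem IsUniformizer.exists_pow_mul {u : K[T;T⁻¹]} (hu : IsUniformizer u) (f : K[T;T⁻¹]) :
    ∃ (n : ℕ) (F : K[X]), u ^ n * f = aeval u F := by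
  have haev : ∀ c, aeval u (Polynomial.C c) = C c := fun c => aeval_C _ _
  have hmul : ∀ f g : K[T;T⁻¹], (∃ (n : ℕ) (F : K[X]), u ^ n * f = aeval u F) →
      (∃ (n : ℕ) (F : K[X]), u ^ n * g = aeval u F) →
      ∃ (n : ℕ) (F : K[X]), u ^ n * (f * g) = aeval u F := by
    rintro f g ⟨n, F, hF⟩ ⟨m, G, hG⟩
    refine ⟨n + m, F * G, ?_⟩
    rw [map_mul, ← hF, ← hG]
    ring
  have hpow : ∀ (f : K[T;T⁻¹]) (k : ℕ), (∃ (n : ℕ) (F : K[X]), u ^ n * f = aeval u F) →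
      ∃ (n : ℕ) (F : K[X]), u ^ n * f ^ k = aeval u F := by
    intro f k hf
    induction k with
    | zero => exact ⟨0, 1, by simp⟩
    | succ k ih => exact pow_succ f k ▸ hmul _ _ ih hf
  have hT : (∃ (n : ℕ) (F : K[X]), u ^ n * T 1 = aeval u F) ∧
      ∃ (n : ℕ) (F : K[X]), u ^ n * T (-1) = aeval u F := by
    obtain ⟨a, ha, h⟩ := hu.exists_eq
    have h1 : C a⁻¹ * C a = (1 : K[T;T⁻¹]) := by rw [← map_mul, inv_mul_cancel₀ ha, map_one]
    have h2 : T 1 * T (-1) = (1 : K[T;T⁻¹]) := by rw [← T_add, add_neg_cancel, T_zero]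
    have key : ∀ x y : K[T;T⁻¹], x * y = 1 → u = C a * x →
        (∃ (n : ℕ) (F : K[X]), u ^ n * x = aeval u F) ∧
          ∃ (n : ℕ) (F : K[X]), u ^ n * y = aeval u F := by
      intro x y hxy hux
      refine ⟨⟨0, Polynomial.C a⁻¹ * X, ?_⟩, ⟨1, Polynomial.C a, ?_⟩⟩
      · rw [map_mul, haev, aeval_X, hux]
        linear_combination -x * h1
      · rw [haev, pow_one, hux]
        linear_combination C a * hxy
    exact h.elim (key _ _ h2) fun h => (key _ _ ((mul_comm _ _).trans h2) h).symm
  have hTk : ∀ k : ℤ, ∃ (n : ℕ) (F : K[X]), u ^ n * T k = aeval u F := by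
    intro k
    obtain ⟨k, rfl | rfl⟩ := k.eq_nat_or_neg
    · simpa [T_pow] using hpow _ k hT.1
    · simpa [T_pow] using hpow _ k hT.2
  induction f using LaurentPolynomial.induction_on' with
  | add f g hf hg =>
    obtain ⟨n, F, hF⟩ := hf
    obtain ⟨m, G, hG⟩ := hg
    refine ⟨n + m, X ^ m * F + X ^ n * G, ?_⟩
    simp only [map_add, map_mul, map_pow, aeval_X, ← hF, ← hG]
    ring
  | C_mul_T k a =>
    obtain ⟨n, F, hF⟩ := hTk k
    refine ⟨n, Polynomial.C a * F, ?_⟩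
    rw [map_mul, haev, ← hF]
    ring

/-- The elements `f` such that the function `d ↦ f(d + 1)` agrees with some Laurent polynomial
(in the variable `u`) away from its poles. -/
def IsShiftable (u f : K[T;T⁻¹]) : Prop :=
  ∃ g : K[T;T⁻¹], ∀ d : K, d ≠ 0 → d + 1 ≠ 0 → ∃ a : K,
    u + -C d ∣ g + -C a ∧ u + -(C d + 1) ∣ f + -C a

theorem isShiftable_aeval (u : K[T;T⁻¹]) (H : K[X]) : IsShiftable u (aeval u H) := by
  have hdvd : ∀ (x : K[T;T⁻¹]) (b : K), x + -C b ∣ aeval x H + -C (H.eval b) := by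
    intro x b
    have := map_dvd (aeval x) (X_sub_C_dvd_sub_C_eval (a := b) (p := H))
    rw [map_sub, map_sub, aeval_X, aeval_C, aeval_C] at this
    rw [← sub_eq_add_neg, ← sub_eq_add_neg]
    exact this
  refine ⟨aeval (u + 1) H, fun d _ _ => ⟨H.eval (d + 1), ?_, ?_⟩⟩
  · convert hdvd (u + 1) (d + 1) using 1
    rw [map_add, map_one]
    ring
  · convert hdvd u (d + 1) using 1
    rw [map_add, map_one]

theorem IsUniformizer.isShiftable_iff [Infinite K] {u : K[T;T⁻¹]} (hu : IsUniformizer u)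
    (f : K[T;T⁻¹]) : IsShiftable u f ↔ f ∈ Set.range (aeval u : K[X] → K[T;T⁻¹]) := by
  refine ⟨?_, by rintro ⟨H, rfl⟩; exact isShiftable_aeval u H⟩
  rintro ⟨g, hg⟩
  obtain ⟨n, F, hF⟩ := hu.exists_pow_mul f
  obtain ⟨m, G, hG⟩ := hu.exists_pow_mul g
  have hval : ∀ (ev : K[T;T⁻¹] →+* K) (b : K), ev u = b → (∀ a, ev (C a) = a) →
      ∀ P : K[X], ev (aeval u P) = P.eval b := by
    intro ev b hb hC P
    rw [aeval_def, hom_eval₂, hb]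
    have : ev.comp (algebraMap K K[T;T⁻¹]) = RingHom.id K := RingHom.ext hC
    rw [this]
    rfl
  have hroot : ∀ (ev : K[T;T⁻¹] →+* K) (b : K), ev u = b → (∀ a, ev (C a) = a) →
      ∀ (h : K[T;T⁻¹]) (a : K), u + -C b ∣ h + -C a → ev h = a := by
    intro ev b hb hC h a hdvd
    have := map_dvd ev hdvd
    rw [map_add, map_add, map_neg, map_neg, hC, hC, hb, add_neg_cancel, zero_dvd_iff] at this
    exact eq_of_sub_eq_zero (by rw [sub_eq_add_neg, this])
  have hFG : (X + 1) ^ n * G = X ^ m * F.comp (X + 1) := by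
    refine Polynomial.eq_of_infinite_eval_eq _ _ (Set.Infinite.mono (s := {0, -1}ᶜ) ?_
      (Set.Finite.infinite_compl (by simp)))
    intro d hd
    simp only [Set.mem_compl_iff, Set.mem_insert_iff, Set.mem_singleton_iff, not_or] at hd
    have hd1 : d + 1 ≠ 0 := fun h => hd.2 (eq_neg_of_add_eq_zero_left h)
    obtain ⟨a, hga, hfa⟩ := hg d hd.1 hd1
    obtain ⟨ev, hev, hC⟩ := hu.exists_eval hd.1
    obtain ⟨ev', hev', hC'⟩ := hu.exists_eval hd1
    rw [← map_one C, ← map_add] at hfa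
    have e1 := congrArg ev hG
    have e2 := congrArg ev' hF
    rw [map_mul, map_pow, hev, hroot ev d hev hC g a hga, hval ev d hev hC] at e1
    rw [map_mul, map_pow, hev', hroot ev' _ hev' hC' f a hfa, hval ev' _ hev' hC'] at e2
    simp only [Set.mem_ofPred_eq, eval_mul, eval_pow, eval_add, eval_X, eval_one, eval_comp, ← e1,
      ← e2]
    ring
  have hdvd : (X + 1) ^ n ∣ F.comp (X + 1) := by
    refine IsCoprime.dvd_of_dvd_mul_left (IsCoprime.pow ?_) (Dvd.intro _ hFG)
    exact ⟨1, -1, by ring⟩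
  obtain ⟨H, hH⟩ := hdvd
  have hFH : F = X ^ n * H.comp (X - 1) := by
    have := congrArg (fun P => P.comp (X - 1)) hH
    simpa [comp_assoc] using this
  refine ⟨H.comp (X - 1), (hu.1.pow n).mul_left_cancel ?_⟩
  rw [hF, hFH, map_mul, map_pow, aeval_X]

theorem IsUniformizer.aeval_injective [Infinite K] {u : K[T;T⁻¹]} (hu : IsUniformizer u) :
    Function.Injective (aeval u : K[X] → K[T;T⁻¹]) := by
  intro P Q hPQ
  refine Polynomial.eq_of_infinite_eval_eq _ _ (Set.Infinite.mono (s := {0}ᶜ) ?_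
    (Set.Finite.infinite_compl (by simp)))
  intro d hd
  obtain ⟨ev, hev, hC⟩ := hu.exists_eval (d := d) hd
  have hev' : ev.comp (algebraMap K K[T;T⁻¹]) = RingHom.id K := RingHom.ext hC
  have := congrArg ev hPQ
  rw [aeval_def, aeval_def, hom_eval₂, hom_eval₂, hev, hev'] at this
  exact this

end LaurentPolynomial

namespace FirstOrder.Ring

open BoundedFormula

variable {α : Type*} {n : ℕ}

/-- Weakening of a term by one bound variable. -/
def weaken (t : Language.ring.Term (α ⊕ Fin n)) : Language.ring.Term (α ⊕ Fin (n + 1)) :=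
  t.relabel (Sum.map id Fin.castSucc)

/-- The formula `s ∣ t`. -/
def dvdFormula (s t : Language.ring.Term (α ⊕ Fin n)) : Language.ring.BoundedFormula α n :=
  ∃' ((weaken t) =' (weaken s * &(Fin.last n)))

/-- The formula describing the constants of a Laurent polynomial ring. -/
def constFormula (t : Language.ring.Term (α ⊕ Fin n)) : Language.ring.BoundedFormula α n :=
  (t =' 0) ⊔ ((t + 1) =' 0) ⊔ (dvdFormula t 1 ⊓ dvdFormula (t + 1) 1)

/-- The formula describing `LaurentPolynomial.IsUniformizer`. -/
def uniformizerFormula : Language.ring.Formula Unit :=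
  let u {k : ℕ} : Language.ring.Term (Unit ⊕ Fin k) := Term.var (Sum.inl ())
  dvdFormula u 1 ⊓ ∼(constFormula u) ⊓
    ∀' ∃' (constFormula (&1) ⊓ dvdFormula (n := 2) (u + -1) (&0 + -&1))

/-- The formula describing `LaurentPolynomial.IsShiftable`. -/
def shiftableFormula : Language.ring.Formula Bool :=
  let u {k : ℕ} : Language.ring.Term (Bool ⊕ Fin k) := Term.var (Sum.inl false)
  let f {k : ℕ} : Language.ring.Term (Bool ⊕ Fin k) := Term.var (Sum.inl true)
  ∃' ∀' (constFormula (n := 2) (&1) ⟹ ∼(&1 =' 0) ⟹ ∼((&1 + 1) =' 0) ⟹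
    ∃' (constFormula (n := 3) (&2) ⊓
      (dvdFormula (u + -&1) (&0 + -&2) ⊓ dvdFormula (u + -(&1 + 1)) (f + -&2))))

section

variable {R : Type*} [CommRing R] [CompatibleRing R] (v : α → R) (xs : Fin n → R)

theorem realize_weaken (t : Language.ring.Term (α ⊕ Fin n)) (x : R) :
    (weaken t).realize (Sum.elim v (Fin.snoc xs x)) = t.realize (Sum.elim v xs) := by
  rw [weaken, Term.realize_relabel]
  congr 1
  funext i
  rcases i with i | i <;> simp

theorem realize_dvdFormula (s t : Language.ring.Term (α ⊕ Fin n)) :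
    (dvdFormula s t).Realize v xs ↔ s.realize (Sum.elim v xs) ∣ t.realize (Sum.elim v xs) := by
  simp [dvdFormula, realize_weaken, Dvd.dvd]

end

variable {K : Type*} [Field K] [CompatibleRing K[T;T⁻¹]]

theorem realize_constFormula (v : α → K[T;T⁻¹]) (xs : Fin n → K[T;T⁻¹])
    (t : Language.ring.Term (α ⊕ Fin n)) :
    (constFormula t).Realize v xs ↔ ∃ a, t.realize (Sum.elim v xs) = LaurentPolynomial.C a := by
  rw [LaurentPolynomial.exists_eq_C_iff]
  simp [constFormula, realize_dvdFormula, isUnit_iff_dvd_one, or_assoc]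

theorem realize_uniformizerFormula (u : K[T;T⁻¹]) :
    uniformizerFormula.Realize (fun _ => u) ↔ LaurentPolynomial.IsUniformizer u := by
  simp [uniformizerFormula, LaurentPolynomial.IsUniformizer, Formula.Realize,
    realize_dvdFormula, realize_constFormula, isUnit_iff_dvd_one, Fin.snoc, and_assoc]

theorem realize_shiftableFormula (u f : K[T;T⁻¹]) :
    shiftableFormula.Realize (fun b => if b then f else u) ↔
      LaurentPolynomial.IsShiftable u f := by
  have h (a : K) : LaurentPolynomial.C a + 1 = 0 ↔ a + 1 = 0 := by
    rw [← map_one LaurentPolynomial.C, ← map_add, map_eq_zero_iff _ LaurentPolynomial.C_injective]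
  simp [h, shiftableFormula, LaurentPolynomial.IsShiftable, Formula.Realize,
    realize_dvdFormula, realize_constFormula, Fin.snoc]

/-- An injective ring homomorphism, as an embedding for the language of rings. -/
def embeddingOfRingHom {R S : Type*} [CommRing R] [CommRing S] [CompatibleRing R]
    [CompatibleRing S] (f : R →+* S) (hf : Function.Injective f) : R ↪[Language.ring] S where
  toFun := f
  inj' := hf
  map_fun' g x := by cases g <;> simp
  map_rel' r := by cases r

theorem isInterpretedBy_coefficients [CompatibleRing K] :
    IsInterpretedBy K K[T;T⁻¹] (⊤ : Language.ring.Formula Unit)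
      (constFormula (n := 0) (Term.var (Sum.inl true)) : Language.ring.Formula Bool) := by
  refine ⟨⟨0, by simp⟩, fun u _ =>
    ⟨embeddingOfRingHom LaurentPolynomial.C LaurentPolynomial.C_injective, fun x => ?_⟩⟩
  rw [Formula.Realize, realize_constFormula]
  simp only [Term.realize_var, Sum.elim_inl, if_true, eq_comm (a := x)]
  rfl

theorem isInterpretedBy_polynomial [Infinite K] [CompatibleRing K[X]] :
    IsInterpretedBy K[X] K[T;T⁻¹] uniformizerFormula shiftableFormula := by
  refine ⟨⟨LaurentPolynomial.T 1, ?_⟩, fun u hu => ?_⟩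
  · rw [realize_uniformizerFormula]
    exact LaurentPolynomial.isUniformizer_T
  · rw [realize_uniformizerFormula] at hu
    refine ⟨embeddingOfRingHom (aeval u : K[X] →ₐ[K] K[T;T⁻¹]).toRingHom hu.aeval_injective,
      fun x => ?_⟩
    rw [realize_shiftableFormula, hu.isShiftable_iff]
    rfl

theorem polynomial_elementarilyEquivalent_of_natCard_eq {K₁ K₂ : Type*} [Field K₁] [Field K₂]
    [CompatibleRing K₁[X]] [CompatibleRing K₂[X]] [Finite K₁] [Finite K₂]
    (h : Nat.card K₁ = Nat.card K₂) : K₁[X] ≅[Language.ring] K₂[X] := by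
  have := Fintype.ofFinite K₁
  have := Fintype.ofFinite K₂
  rw [Nat.card_eq_fintype_card, Nat.card_eq_fintype_card] at h
  exact StrongHomClass.elementarilyEquivalent (languageEquivEquivRingEquiv.symm
    (Polynomial.mapEquiv (FiniteField.ringEquivOfCardEq h)))

end FirstOrder.Ring

/-- If the Laurent polynomial rings `K₁[t,t⁻¹]` and `K₂[t,t⁻¹]` over fields `K₁`, `K₂`
are elementarily equivalent as rings, then the polynomial rings `K₁[t]` and `K₂[t]`
are elementarily equivalent as rings. -/
theorem laurent_elementarilyEquivalent_implies_polynomial_elementarilyEquivalent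
    (K₁ K₂ : Type*) [Field K₁] [Field K₂] :
    letI := compatibleRingOfRing K₁[T;T⁻¹]
    letI := compatibleRingOfRing K₂[T;T⁻¹]
    letI := compatibleRingOfRing K₁[X]
    letI := compatibleRingOfRing K₂[X]
    (K₁[T;T⁻¹] ≅[Language.ring] K₂[T;T⁻¹]) → (K₁[X] ≅[Language.ring] K₂[X]) := by
  intro h
  let _ := compatibleRingOfRing K₁
  let _ := compatibleRingOfRing K₂
  let _ := compatibleRingOfRing K₁[T;T⁻¹]
  let _ := compatibleRingOfRing K₂[T;T⁻¹]
  let _ := compatibleRingOfRing K₁[X]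
  let _ := compatibleRingOfRing K₂[X]
  have hK : K₁ ≅[Language.ring] K₂ :=
    isInterpretedBy_coefficients.elementarilyEquivalent isInterpretedBy_coefficients h
  cases finite_or_infinite K₁
  · obtain ⟨_, hcard⟩ := hK.natCard_eq
    exact polynomial_elementarilyEquivalent_of_natCard_eq hcard
  · have : Infinite K₂ := hK.infinite_iff.1 inferInstance
    exact isInterpretedBy_polynomial.elementarilyEquivalent isInterpretedBy_polynomial h
end

section
/- Let K₁ and K₂ be infinite fields of characteristic zero. If the Laurent polynomial rings K₁[t,t⁻¹] and K₂[t,t⁻¹] are elementarily equivalent as rings, then the transcendence degrees of K₁ and K₂ over ℚ are either both infinite, or both finite and equal. -/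
open FirstOrder Language FirstOrder.Ring LaurentPolynomial Cardinal

/-- The transcendence degree of a field `K` of characteristic zero over its prime
subfield `ℚ`: the supremum of the cardinalities of the `ℚ`-algebraically independent
subsets of `K` (this equals the cardinality of any transcendence basis of `K` over `ℚ`). -/
noncomputable def trdegQ (K : Type*) [Field K] [CharZero K] : Cardinal :=
  ⨆ s : {s : Set K // AlgebraicIndependent ℚ ((↑) : s → K)}, Cardinal.mk s.1

universe u

/-- A pair of functions is term-definable when one term of the language of rings
computes the first in `M` and the second in `N`. -/
def CommonTerm {α M N : Type*} [CommRing M] [CommRing N] [CompatibleRing M] [CompatibleRing N]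
    (s : (α → M) → M) (t : (α → N) → N) : Prop :=
  ∃ φ : Language.ring.Term α, (∀ v, φ.realize v = s v) ∧ ∀ v, φ.realize v = t v

/-- A pair of predicates is definable when one first-order formula of the language of rings
defines the first in `M` and the second in `N`. -/
def CommonDef {α M N : Type*} [CommRing M] [CommRing N] [CompatibleRing M] [CompatibleRing N]
    (P : (α → M) → Prop) (Q : (α → N) → Prop) : Prop :=
  ∃ φ : Language.ring.Formula α, (∀ v, φ.Realize v ↔ P v) ∧ ∀ v, φ.Realize v ↔ Q v

section Definability

variable {α : Type} {M N : Type*} [CommRing M] [CommRing N] [CompatibleRing M] [CompatibleRing N]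

namespace CommonTerm

variable {s s' : (α → M) → M} {t t' : (α → N) → N}

lemma var (i : α) : CommonTerm (fun v : α → M => v i) (fun v : α → N => v i) :=
  ⟨Term.var i, fun _ => rfl, fun _ => rfl⟩

lemma zero : CommonTerm (fun _ : α → M => 0) (fun _ : α → N => 0) :=
  ⟨0, by simp, by simp⟩

lemma one : CommonTerm (fun _ : α → M => 1) (fun _ : α → N => 1) :=
  ⟨1, by simp, by simp⟩

lemma add (h : CommonTerm s t) (h' : CommonTerm s' t') :
    CommonTerm (fun v => s v + s' v) (fun v => t v + t' v) := by
  obtain ⟨φ, h₁, h₂⟩ := h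
  obtain ⟨ψ, h₁', h₂'⟩ := h'
  exact ⟨φ + ψ, by simp [h₁, h₁'], by simp [h₂, h₂']⟩

lemma sub (h : CommonTerm s t) (h' : CommonTerm s' t') :
    CommonTerm (fun v => s v - s' v) (fun v => t v - t' v) := by
  obtain ⟨φ, h₁, h₂⟩ := h
  obtain ⟨ψ, h₁', h₂'⟩ := h'
  exact ⟨φ + -ψ, by simp [h₁, h₁', sub_eq_add_neg], by simp [h₂, h₂', sub_eq_add_neg]⟩

lemma mul (h : CommonTerm s t) (h' : CommonTerm s' t') :
    CommonTerm (fun v => s v * s' v) (fun v => t v * t' v) := by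
  obtain ⟨φ, h₁, h₂⟩ := h
  obtain ⟨ψ, h₁', h₂'⟩ := h'
  exact ⟨φ * ψ, by simp [h₁, h₁'], by simp [h₂, h₂']⟩

lemma weaken {β : Type} (h : CommonTerm s t) :
    CommonTerm (fun v : α ⊕ β → M => s fun i => v (.inl i))
      (fun v : α ⊕ β → N => t fun i => v (.inl i)) := by
  obtain ⟨φ, h₁, h₂⟩ := h
  refine ⟨φ.relabel Sum.inl, fun v => ?_, fun v => ?_⟩
  · rw [Term.realize_relabel, h₁]; rfl
  · rw [Term.realize_relabel, h₂]; rfl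

end CommonTerm

namespace CommonDef

variable {P P' : (α → M) → Prop} {Q Q' : (α → N) → Prop}
  {s s' s'' s₃ : (α → M) → M} {t t' t'' t₃ : (α → N) → N}

lemma eq (h : CommonTerm s t) (h' : CommonTerm s' t') :
    CommonDef (fun v => s v = s' v) (fun v => t v = t' v) := by
  obtain ⟨φ, h₁, h₂⟩ := h
  obtain ⟨ψ, h₁', h₂'⟩ := h'
  exact ⟨φ.equal ψ, by simp [h₁, h₁'], by simp [h₂, h₂']⟩

lemma not (h : CommonDef P Q) : CommonDef (fun v => ¬ P v) (fun v => ¬ Q v) := by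
  obtain ⟨φ, h₁, h₂⟩ := h
  exact ⟨∼φ, by simp [h₁], by simp [h₂]⟩

lemma and (h : CommonDef P Q) (h' : CommonDef P' Q') :
    CommonDef (fun v => P v ∧ P' v) (fun v => Q v ∧ Q' v) := by
  obtain ⟨φ, h₁, h₂⟩ := h
  obtain ⟨ψ, h₁', h₂'⟩ := h'
  exact ⟨φ ⊓ ψ, by simp [h₁, h₁'], by simp [h₂, h₂']⟩

lemma or (h : CommonDef P Q) (h' : CommonDef P' Q') :
    CommonDef (fun v => P v ∨ P' v) (fun v => Q v ∨ Q' v) := by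
  obtain ⟨φ, h₁, h₂⟩ := h
  obtain ⟨ψ, h₁', h₂'⟩ := h'
  exact ⟨φ ⊔ ψ, by simp [h₁, h₁'], by simp [h₂, h₂']⟩

lemma imp (h : CommonDef P Q) (h' : CommonDef P' Q') :
    CommonDef (fun v => P v → P' v) (fun v => Q v → Q' v) := by
  obtain ⟨φ, h₁, h₂⟩ := h
  obtain ⟨ψ, h₁', h₂'⟩ := h'
  exact ⟨φ.imp ψ, by simp [h₁, h₁'], by simp [h₂, h₂']⟩

lemma existsIndex {ι : Type} [Finite ι] {P : ι → (α → M) → Prop} {Q : ι → (α → N) → Prop}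
    (h : ∀ k, CommonDef (P k) (Q k)) : CommonDef (fun v => ∃ k, P k v) (fun v => ∃ k, Q k v) := by
  choose φ h₁ h₂ using h
  exact ⟨.iSup φ, by simp [h₁], by simp [h₂]⟩

lemma forallIndex {ι : Type} [Finite ι] {P : ι → (α → M) → Prop} {Q : ι → (α → N) → Prop}
    (h : ∀ k, CommonDef (P k) (Q k)) : CommonDef (fun v => ∀ k, P k v) (fun v => ∀ k, Q k v) := by
  choose φ h₁ h₂ using h
  exact ⟨.iInf φ, by simp [h₁], by simp [h₂]⟩

lemma existsTuple {ι : Type} [Finite ι] {P : (α → M) → (ι → M) → Prop}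
    {Q : (α → N) → (ι → N) → Prop}
    (h : CommonDef (fun v : α ⊕ ι → M => P (fun i => v (.inl i)) fun k => v (.inr k))
      (fun v : α ⊕ ι → N => Q (fun i => v (.inl i)) fun k => v (.inr k))) :
    CommonDef (fun v => ∃ x, P v x) (fun v => ∃ x, Q v x) := by
  obtain ⟨φ, h₁, h₂⟩ := h
  exact ⟨φ.iExs ι, by simp [Formula.realize_iExs, h₁], by simp [Formula.realize_iExs, h₂]⟩

lemma ex {P : (α → M) → M → Prop} {Q : (α → N) → N → Prop}
    (h : CommonDef (fun v : α ⊕ Unit → M => P (fun i => v (.inl i)) (v (.inr ())))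
      (fun v : α ⊕ Unit → N => Q (fun i => v (.inl i)) (v (.inr ())))) :
    CommonDef (fun v => ∃ x, P v x) (fun v => ∃ x, Q v x) := by
  obtain ⟨φ, h₁, h₂⟩ := h
  refine ⟨φ.iExs Unit, fun v => ?_, fun v => ?_⟩ <;> rw [Formula.realize_iExs]
  · exact ⟨fun ⟨x, hx⟩ => ⟨x (), (h₁ _).1 hx⟩, fun ⟨x, hx⟩ => ⟨fun _ => x, (h₁ _).2 hx⟩⟩
  · exact ⟨fun ⟨x, hx⟩ => ⟨x (), (h₂ _).1 hx⟩, fun ⟨x, hx⟩ => ⟨fun _ => x, (h₂ _).2 hx⟩⟩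

lemma all {P : (α → M) → M → Prop} {Q : (α → N) → N → Prop}
    (h : CommonDef (fun v : α ⊕ Unit → M => P (fun i => v (.inl i)) (v (.inr ())))
      (fun v : α ⊕ Unit → N => Q (fun i => v (.inl i)) (v (.inr ())))) :
    CommonDef (fun v => ∀ x, P v x) (fun v => ∀ x, Q v x) := by
  obtain ⟨φ, h₁, h₂⟩ := h
  refine ⟨φ.iAlls Unit, fun v => ?_, fun v => ?_⟩ <;> rw [Formula.realize_iAlls]
  · exact ⟨fun h x => (h₁ _).1 (h fun _ => x), fun h x => (h₁ _).2 (h (x ()))⟩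
  · exact ⟨fun h x => (h₂ _).1 (h fun _ => x), fun h x => (h₂ _).2 (h (x ()))⟩

lemma dvd (h : CommonTerm s t) (h' : CommonTerm s' t') :
    CommonDef (fun v => s v ∣ s' v) (fun v => t v ∣ t' v) :=
  ex (eq h'.weaken (.mul h.weaken (.var _)))

lemma isUnit (h : CommonTerm s t) :
    CommonDef (fun v => IsUnit (s v)) (fun v => IsUnit (t v)) := by
  simp only [isUnit_iff_dvd_one]
  exact dvd h .one

end CommonDef

end Definability

/-- In a Laurent polynomial ring over a field, this defines the constants. -/
def IsConst {R : Type*} [CommRing R] (x : R) : Prop :=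
  x = 0 ∨ x + 1 = 0 ∨ IsUnit x ∧ IsUnit (x + 1)

/-- In a Laurent polynomial ring over a field of characteristic zero, this defines `ℤ`. -/
def IsIntConst {R : Type*} [CommRing R] (r : R) : Prop :=
  IsConst r ∧ ∀ g, IsUnit g → ¬ IsConst g →
    ∃ u, IsUnit u ∧ (g - 1) * (g - 1) ∣ u - 1 - r * (g - 1)

/-- In a Laurent polynomial ring over a field of characteristic zero, this defines `ℕ`. -/
def IsNatConst {R : Type*} [CommRing R] (r : R) : Prop :=
  ∃ a b c d, IsIntConst a ∧ IsIntConst b ∧ IsIntConst c ∧ IsIntConst d ∧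
    r = a * a + b * b + c * c + d * d

/-- The element `f` takes the constant value `y` at the point `e = i`. -/
def HasValue {R : Type*} [CommRing R] (e f i y : R) : Prop :=
  IsConst y ∧ e - i ∣ f - y

/-- The pair of values of `f` and `h` at `i` is `(1, 1)`, some `(a k, z k)`, or the difference
or product of the pairs of values at two smaller natural numbers. -/
def IsStep {R ι : Type*} [CommRing R] (a z : ι → R) (e f h i : R) : Prop :=
  ∃ u v, HasValue e f i u ∧ HasValue e h i v ∧
    ((u = 1 ∧ v = 1) ∨ (∃ k, u = a k ∧ v = z k) ∨
      ∃ j l, IsNatConst j ∧ IsNatConst l ∧ IsNatConst (i - 1 - j) ∧ IsNatConst (i - 1 - l) ∧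
        ∃ u₁ v₁ u₂ v₂, HasValue e f j u₁ ∧ HasValue e h j v₁ ∧
          HasValue e f l u₂ ∧ HasValue e h l v₂ ∧
          ((u = u₁ - u₂ ∧ v = v₁ - v₂) ∨ (u = u₁ * u₂ ∧ v = v₁ * v₂)))

/-- Some pair `(0, w)` with `w ≠ 0` is reached by a finite computation of the subring generated
by the pairs `(a k, z k)`, the computation being coded by the values of `f` and `h`. In a Laurent
polynomial ring over a field of characteristic zero, this defines algebraic dependence of a tuple
of constants over `ℤ`. -/
def IsDependent {R ι : Type*} [CommRing R] (a : ι → R) : Prop :=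
  ∃ e, (∀ i, IsNatConst i → ¬ IsUnit (e - i)) ∧ ∃ z : ι → R, (∀ k, IsConst (z k)) ∧
    ∃ f h n w, IsNatConst n ∧ HasValue e f n 0 ∧ HasValue e h n w ∧ w ≠ 0 ∧
      ∀ i, IsNatConst i → IsNatConst (n - i) → IsStep a z e f h i

section Definability

variable {α : Type} {M N : Type*} [CommRing M] [CommRing N] [CompatibleRing M] [CompatibleRing N]

namespace CommonDef

variable {s s' s'' s₃ : (α → M) → M} {t t' t'' t₃ : (α → N) → N}

lemma isConst (h : CommonTerm s t) :
    CommonDef (fun v => IsConst (s v)) (fun v => IsConst (t v)) :=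
  .or (.eq h .zero) (.or (.eq (h.add .one) .zero) (.and (.isUnit h) (.isUnit (h.add .one))))

lemma isIntConst (h : CommonTerm s t) :
    CommonDef (fun v => IsIntConst (s v)) (fun v => IsIntConst (t v)) :=
  .and (.isConst h) (.all (.imp (.isUnit (.var _)) (.imp (.not (.isConst (.var _)))
    (.ex (.and (.isUnit (.var _)) (.dvd
      (.mul (.sub (.var _) .one) (.sub (.var _) .one))
      (.sub (.sub (.var _) .one) (.mul h.weaken.weaken (.sub (.var _) .one)))))))))

lemma isNatConst (h : CommonTerm s t) :
    CommonDef (fun v => IsNatConst (s v)) (fun v => IsNatConst (t v)) :=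
  .ex <| .ex <| .ex <| .ex <| .and (.isIntConst (.var _)) <| .and (.isIntConst (.var _)) <|
    .and (.isIntConst (.var _)) <| .and (.isIntConst (.var _)) <|
    .eq h.weaken.weaken.weaken.weaken (.add (.add (.add (.mul (.var _) (.var _))
      (.mul (.var _) (.var _))) (.mul (.var _) (.var _))) (.mul (.var _) (.var _)))

lemma hasValue (h : CommonTerm s t) (h' : CommonTerm s' t') (h'' : CommonTerm s'' t'')
    (h₃ : CommonTerm s₃ t₃) :
    CommonDef (fun v => HasValue (s v) (s' v) (s'' v) (s₃ v))
      (fun v => HasValue (t v) (t' v) (t'' v) (t₃ v)) :=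
  .and (.isConst h₃) (.dvd (h.sub h'') (h'.sub h₃))

lemma isStep {ι : Type} [Finite ι] (a z : ι → α) (e f h i : α) :
    CommonDef (fun v : α → M => IsStep (fun k => v (a k)) (fun k => v (z k)) (v e) (v f) (v h) (v i))
      (fun v : α → N => IsStep (fun k => v (a k)) (fun k => v (z k)) (v e) (v f) (v h) (v i)) :=
  .ex <| .ex <| .and (.hasValue (.var _) (.var _) (.var _) (.var _)) <|
    .and (.hasValue (.var _) (.var _) (.var _) (.var _)) <|
    .or (.and (.eq (.var _) .one) (.eq (.var _) .one)) <|
    .or (.existsIndex fun _ => .and (.eq (.var _) (.var _)) (.eq (.var _) (.var _))) <|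
    .ex <| .ex <| .and (.isNatConst (.var _)) <| .and (.isNatConst (.var _)) <|
    .and (.isNatConst (.sub (.sub (.var _) .one) (.var _))) <|
    .and (.isNatConst (.sub (.sub (.var _) .one) (.var _))) <|
    .ex <| .ex <| .ex <| .ex <| .and (.hasValue (.var _) (.var _) (.var _) (.var _)) <|
    .and (.hasValue (.var _) (.var _) (.var _) (.var _)) <|
    .and (.hasValue (.var _) (.var _) (.var _) (.var _)) <|
    .and (.hasValue (.var _) (.var _) (.var _) (.var _)) <|
    .or (.and (.eq (.var _) (.sub (.var _) (.var _))) (.eq (.var _) (.sub (.var _) (.var _))))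
      (.and (.eq (.var _) (.mul (.var _) (.var _))) (.eq (.var _) (.mul (.var _) (.var _))))

lemma isDependent {ι : Type} [Finite ι] (a : ι → α) :
    CommonDef (fun v : α → M => IsDependent fun k => v (a k))
      (fun v : α → N => IsDependent fun k => v (a k)) :=
  .ex <| .and (.all (.imp (.isNatConst (.var _)) (.not (.isUnit (.sub (.var _) (.var _)))))) <|
    .existsTuple <| .and (.forallIndex fun _ => .isConst (.var _)) <|
    .ex <| .ex <| .ex <| .ex <| .and (.isNatConst (.var _)) <|
    .and (.hasValue (.var _) (.var _) (.var _) .zero) <|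
    .and (.hasValue (.var _) (.var _) (.var _) (.var _)) <|
    .and (.not (.eq (.var _) .zero)) <|
    .all <| .imp (.isNatConst (.var _)) <| .imp (.isNatConst (.sub (.var _) (.var _))) <|
    .isStep _ _ _ _ _ _

end CommonDef

/-- Elementarily equivalent rings agree on the existence of independent tuples of constants. -/
lemma FirstOrder.Language.ElementarilyEquivalent.exists_not_isDependent_iff
    (hMN : M ≅[Language.ring] N) (n : ℕ) :
    (∃ a : Fin n → M, (∀ k, IsConst (a k)) ∧ ¬ IsDependent a) ↔
      ∃ a : Fin n → N, (∀ k, IsConst (a k)) ∧ ¬ IsDependent a := by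
  have key : CommonDef
      (fun _ : Empty → M => ∃ a : Fin n → M, (∀ k, IsConst (a k)) ∧ ¬ IsDependent a)
      (fun _ : Empty → N => ∃ a : Fin n → N, (∀ k, IsConst (a k)) ∧ ¬ IsDependent a) :=
    .existsTuple <| .and (.forallIndex fun _ => .isConst (.var _)) <| .not (.isDependent _)
  obtain ⟨φ, h₁, h₂⟩ := key
  exact (h₁ default).symm.trans ((hMN.realize_sentence φ).trans (h₂ default))

end Definability

section LaurentPolynomial

variable {K : Type*} [Field K]

lemma LaurentPolynomial.exists_eq_C_mul_T_of_isUnit {x : K[T;T⁻¹]} (hx : IsUnit x) :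
    ∃ (c : K) (n : ℤ), c ≠ 0 ∧ x = C c * T n := by
  obtain ⟨y, hxy⟩ := hx.exists_right_inv
  obtain ⟨n, p, hp⟩ := exists_T_pow x
  obtain ⟨m, q, hq⟩ := exists_T_pow y
  have hpq : p * q = Polynomial.X ^ (n + m) := by
    apply Polynomial.toLaurent_injective
    rw [map_mul, hp, hq, Polynomial.toLaurent_X_pow, Nat.cast_add, T_add,
      show x * T (n : ℤ) * (y * T (m : ℤ)) = x * y * (T (n : ℤ) * T (m : ℤ)) by ring, hxy, one_mul]
  obtain ⟨i, -, hi⟩ := (dvd_prime_pow Polynomial.prime_X _).1 (Dvd.intro _ hpq)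
  obtain ⟨u, hu⟩ := hi.symm
  obtain ⟨c, hc, hcu⟩ := Polynomial.isUnit_iff.1 u.isUnit
  refine ⟨c, i - n, hc.ne_zero, ?_⟩
  rw [← hu, ← hcu, map_mul, Polynomial.toLaurent_X_pow, Polynomial.toLaurent_C] at hp
  rw [T_sub, ← mul_assoc, mul_comm (C c), hp, mul_T_assoc]
  simp

lemma isConst_iff {x : K[T;T⁻¹]} : IsConst x ↔ ∃ c : K, x = C c := by
  constructor
  · rintro (rfl | h | ⟨h, h'⟩)
    · exact ⟨0, by simp⟩
    · exact ⟨-1, by rw [eq_neg_of_add_eq_zero_left h]; simp⟩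
    · obtain ⟨c, n, hc, rfl⟩ := exists_eq_C_mul_T_of_isUnit h
      obtain ⟨d, m, hd, hm⟩ := exists_eq_C_mul_T_of_isUnit h'
      rcases eq_or_ne n 0 with rfl | hn
      · exact ⟨c, by simp⟩
      · have coeff_eq (j : ℤ) := congrArg (fun p : K[T;T⁻¹] => p.coeff j) hm
        have h₀ := coeff_eq 0
        have h₁ := coeff_eq n
        rw [← single_eq_C_mul_T, ← single_eq_C_mul_T, ← single_zero_one_eq_one] at h₀ h₁
        simp only [AddMonoidAlgebra.coeff_add, AddMonoidAlgebra.coeff_single, Finsupp.add_apply,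
          Finsupp.single_apply] at h₀ h₁
        grind
  · rintro ⟨c, rfl⟩
    rcases eq_or_ne c 0 with rfl | hc
    · exact .inl (map_zero C)
    rcases eq_or_ne (c + 1) 0 with hc' | hc'
    · exact .inr (.inl (by rw [← map_one C, ← map_add, hc', map_zero]))
    · exact .inr (.inr ⟨hc.isUnit.map C, by
        simpa using hc'.isUnit.map (C : K →+* K[T;T⁻¹])⟩)

lemma isConst_C (c : K) : IsConst (C c : K[T;T⁻¹]) := isConst_iff.2 ⟨c, rfl⟩

lemma LaurentPolynomial.C_injective_s3 : Function.Injective (C : K →+* K[T;T⁻¹]) :=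
  (C : K →+* K[T;T⁻¹]).injective

lemma Units.sq_dvd_zpow_sub {R : Type*} [CommRing R] (g : Rˣ) (k : ℤ) :
    ((g : R) - 1) * (g - 1) ∣ ((g ^ k : Rˣ) : R) - 1 - k * (g - 1) := by
  induction k using Int.induction_on with
  | zero => simp
  | succ k ih =>
    obtain ⟨h, hh⟩ := ih
    refine ⟨g * h + k, ?_⟩
    rw [zpow_add_one, Units.val_mul]
    push_cast at hh ⊢
    linear_combination (g : R) * hh
  | pred k ih =>
    obtain ⟨h, hh⟩ := ih
    refine ⟨((g⁻¹ : Rˣ) : R) * (h + k + 1), ?_⟩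
    rw [zpow_sub_one, Units.val_mul]
    push_cast at hh ⊢
    have hg : (g : R) * ((g⁻¹ : Rˣ) : R) = 1 := by simp
    linear_combination ((g⁻¹ : Rˣ) : R) * hh + (1 + (-k - 1) * ((g : R) - 1)) * hg

lemma not_isConst_T_one : ¬ IsConst (T 1 : K[T;T⁻¹]) := by
  rw [isConst_iff]
  rintro ⟨c, hc⟩
  simpa using congrArg (fun p : K[T;T⁻¹] => p.coeff 1) hc

lemma isIntConst_iff {r : K[T;T⁻¹]} : IsIntConst r ↔ ∃ k : ℤ, r = k := by
  constructor
  · rintro ⟨hr, h⟩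
    obtain ⟨r, rfl⟩ := isConst_iff.1 hr
    obtain ⟨u, hu, hdvd⟩ := h (T 1) (isUnit_T 1) not_isConst_T_one
    obtain ⟨d, k, -, rfl⟩ := exists_eq_C_mul_T_of_isUnit hu
    have heps : (DualNumber.eps * DualNumber.eps : DualNumber K) = 0 := DualNumber.eps_mul_eps
    let g : (DualNumber K)ˣ := ⟨1 + DualNumber.eps, 1 - DualNumber.eps,
      by linear_combination -heps, by linear_combination -heps⟩
    have hg : (g : DualNumber K) - 1 = DualNumber.eps := add_sub_cancel_left _ _
    have hpow := g.sq_dvd_zpow_sub k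
    have himage := map_dvd (eval₂ (TrivSqZeroExt.inlHom K K) g : K[T;T⁻¹] →+* DualNumber K) hdvd
    simp only [map_mul, map_sub, map_one, eval₂_T, eval₂_C, zpow_one, hg, heps,
      zero_dvd_iff] at hpow himage
    rw [sub_sub, sub_eq_zero] at hpow
    rw [hpow] at himage
    refine ⟨k, ?_⟩
    have h₁ := congrArg TrivSqZeroExt.fst himage
    have h₂ := congrArg TrivSqZeroExt.snd himage
    simp at h₁ h₂
    rw [sub_eq_zero] at h₁
    subst h₁
    rw [← map_intCast (C : K →+* K[T;T⁻¹]), C_injective_s3.eq_iff]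
    linear_combination -h₂
  · rintro ⟨k, rfl⟩
    refine ⟨isConst_iff.2 ⟨k, by simp⟩, fun g hg _ => ?_⟩
    obtain ⟨g, rfl⟩ := hg
    exact ⟨_, (g ^ k).isUnit, g.sq_dvd_zpow_sub k⟩

lemma isNatConst_iff [CharZero K] {r : K[T;T⁻¹]} : IsNatConst r ↔ ∃ k : ℕ, r = k := by
  simp only [IsNatConst, isIntConst_iff]
  constructor
  · rintro ⟨_, _, _, _, ⟨a, rfl⟩, ⟨b, rfl⟩, ⟨c, rfl⟩, ⟨d, rfl⟩, rfl⟩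
    refine ⟨(a * a + b * b + c * c + d * d).toNat, ?_⟩
    have h : ((a * a + b * b + c * c + d * d).toNat : ℤ) = a * a + b * b + c * c + d * d :=
      Int.toNat_of_nonneg (by nlinarith)
    exact_mod_cast congrArg (Int.cast : ℤ → K[T;T⁻¹]) h.symm
  · rintro ⟨k, rfl⟩
    obtain ⟨a, b, c, d, rfl⟩ := Nat.sum_four_squares k
    exact ⟨a, b, c, d, ⟨a, by simp⟩, ⟨b, by simp⟩, ⟨c, by simp⟩, ⟨d, by simp⟩, by
      push_cast; ring⟩

lemma LaurentPolynomial.natCast_inj [CharZero K] {m n : ℕ} :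
    (m : K[T;T⁻¹]) = n ↔ m = n := by
  rw [← map_natCast C, ← map_natCast C, C_injective_s3.eq_iff, Nat.cast_inj]

lemma isNatConst_natCast [CharZero K] (n : ℕ) : IsNatConst (n : K[T;T⁻¹]) :=
  isNatConst_iff.2 ⟨n, rfl⟩

lemma isNatConst_natCast_sub_iff [CharZero K] {m n : ℕ} :
    IsNatConst ((n : K[T;T⁻¹]) - m) ↔ m ≤ n := by
  rw [isNatConst_iff]
  constructor
  · rintro ⟨k, hk⟩
    rw [sub_eq_iff_eq_add, ← Nat.cast_add, natCast_inj] at hk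
    omega
  · exact fun h => ⟨n - m, by rw [Nat.cast_sub h]⟩

lemma isNatConst_natCast_sub_one_sub_iff [CharZero K] {m n : ℕ} :
    IsNatConst ((n : K[T;T⁻¹]) - 1 - m) ↔ m < n := by
  rw [sub_sub, add_comm, ← Nat.cast_one, ← Nat.cast_add, isNatConst_natCast_sub_iff,
    Nat.succ_le_iff]

lemma hasValue_C {e f i : K[T;T⁻¹]} {c : K} : HasValue e f i (C c) ↔ e - i ∣ f - C c :=
  and_iff_right (isConst_C c)

lemma HasValue.exists_C {e f i y : K[T;T⁻¹]} (h : HasValue e f i y) : ∃ c, y = C c :=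
  isConst_iff.1 h.1

lemma HasValue.unique {e f i y y' : K[T;T⁻¹]} (he : ¬ IsUnit (e - i)) (h : HasValue e f i y)
    (h' : HasValue e f i y') : y = y' := by
  obtain ⟨c, rfl⟩ := h.exists_C
  obtain ⟨d, rfl⟩ := h'.exists_C
  by_contra hcd
  have hdvd := dvd_sub h'.2 h.2
  rw [sub_sub_sub_cancel_left, ← map_sub] at hdvd
  refine he (isUnit_of_dvd_unit hdvd (IsUnit.map C (sub_ne_zero.2 ?_).isUnit))
  rintro rfl
  exact hcd rfl

/-- The subring of `K × K` generated by the pairs `(a k, z k)`. -/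
def pairSubring {ι : Type*} (a z : ι → K) : Subring (K × K) :=
  Subring.closure (Set.range fun k => (a k, z k))

lemma mem_pairSubring_iff {ι : Type*} {a z : ι → K} {x : K × K} :
    x ∈ pairSubring a z ↔
      ∃ p : MvPolynomial ι ℤ, MvPolynomial.aeval a p = x.1 ∧ MvPolynomial.aeval z p = x.2 := by
  have h : x ∈ pairSubring a z ↔
      x ∈ Algebra.adjoin ℤ (Set.range fun k => (a k, z k)) := by
    rw [Subsingleton.elim (Prod.algebra ℤ K K) (Ring.toIntAlgebra _), Algebra.adjoin_int]
    rfl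
  rw [h, Algebra.adjoin_range_eq_range_aeval, AlgHom.mem_range]
  refine exists_congr fun p => ?_
  have h₁ : (MvPolynomial.aeval fun k => (a k, z k)) p =
      (MvPolynomial.aeval a p, MvPolynomial.aeval z p) := by
    apply Prod.ext
    · exact DFunLike.congr_fun (MvPolynomial.algHom_ext
        (f := (AlgHom.fst ℤ K K).comp (MvPolynomial.aeval fun k => (a k, z k)))
        (g := MvPolynomial.aeval a) (by simp)) p
    · exact DFunLike.congr_fun (MvPolynomial.algHom_ext
        (f := (AlgHom.snd ℤ K K).comp (MvPolynomial.aeval fun k => (a k, z k)))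
        (g := MvPolynomial.aeval z) (by simp)) p
  rw [h₁, Prod.ext_iff]

/-- The sequence `s` is, up to index `n`, a computation in which each entry is `1`, a generator,
or the difference or product of two earlier entries. -/
def IsComputation {A : Type*} [Ring A] (S : Set A) (s : ℕ → A) (n : ℕ) : Prop :=
  ∀ i ≤ n, s i = 1 ∨ s i ∈ S ∨
    ∃ j < i, ∃ l < i, s i = s j - s l ∨ s i = s j * s l

lemma IsComputation.combine {A : Type*} [Ring A] {S : Set A} {s₁ s₂ : ℕ → A} {n₁ n₂ : ℕ}
    (h₁ : IsComputation S s₁ n₁) (h₂ : IsComputation S s₂ n₂) {x : A}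
    (hx : x = s₁ n₁ - s₂ n₂ ∨ x = s₁ n₁ * s₂ n₂) :
    ∃ s n, IsComputation S s n ∧ s n = x := by
  set s : ℕ → A := fun i => if i ≤ n₁ then s₁ i else if i ≤ n₁ + 1 + n₂ then s₂ (i - (n₁ + 1))
    else x
  have hs₁ (i) (hi : i ≤ n₁) : s i = s₁ i := if_pos hi
  have hs₂ (i) (hi : i ≤ n₂) : s (n₁ + 1 + i) = s₂ i := by
    simp [s, hi, show ¬ n₁ + 1 + i ≤ n₁ by omega]
  have hs₃ : s (n₁ + 1 + n₂ + 1) = x := by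
    simp [s, show ¬ n₁ + 1 + n₂ + 1 ≤ n₁ by omega]
  refine ⟨s, n₁ + 1 + n₂ + 1, fun i hi => ?_, hs₃⟩
  rcases le_or_gt i n₁ with hi₁ | hi₁
  · rw [hs₁ i hi₁]
    refine (h₁ i hi₁).imp id (.imp id ?_)
    rintro ⟨j, hj, l, hl, h⟩
    exact ⟨j, hj, l, hl, by rwa [hs₁ j (by omega), hs₁ l (by omega)]⟩
  rcases le_or_gt i (n₁ + 1 + n₂) with hi₂ | hi₂
  · obtain ⟨k, rfl⟩ := Nat.exists_eq_add_of_le (Nat.succ_le_of_lt hi₁)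
    have hk : k ≤ n₂ := by omega
    rw [Nat.succ_eq_add_one, hs₂ k hk]
    refine (h₂ k hk).imp id (.imp id ?_)
    rintro ⟨j, hj, l, hl, h⟩
    exact ⟨n₁ + 1 + j, by omega, n₁ + 1 + l, by omega, by
      rwa [hs₂ j (by omega), hs₂ l (by omega)]⟩
  · obtain rfl : i = n₁ + 1 + n₂ + 1 := by omega
    exact .inr (.inr ⟨n₁, by omega, n₁ + 1 + n₂, by omega, by
      rwa [hs₃, hs₁ n₁ le_rfl, hs₂ n₂ le_rfl]⟩)

lemma exists_isComputation_of_mem_closure {A : Type*} [Ring A] {S : Set A} {x : A}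
    (hx : x ∈ Subring.closure S) : ∃ s n, IsComputation S s n ∧ s n = x := by
  have one : ∃ s n, IsComputation S s n ∧ s n = 1 := ⟨fun _ => 1, 0, fun _ _ => .inl rfl, rfl⟩
  have sub {x y : A} (hx : ∃ s n, IsComputation S s n ∧ s n = x)
      (hy : ∃ s n, IsComputation S s n ∧ s n = y) :
      ∃ s n, IsComputation S s n ∧ s n = x - y := by
    obtain ⟨s₁, n₁, h₁, rfl⟩ := hx
    obtain ⟨s₂, n₂, h₂, rfl⟩ := hy
    exact h₁.combine h₂ (.inl rfl)
  have zero : ∃ s n, IsComputation S s n ∧ s n = 0 := by simpa using sub one one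
  induction hx using Subring.closure_induction with
  | mem x hx => exact ⟨fun _ => x, 0, fun _ _ => .inr (.inl hx), rfl⟩
  | zero => exact zero
  | one => exact one
  | add x y _ _ hx hy => simpa using sub hx (sub zero hy)
  | neg x _ hx => simpa using sub zero hx
  | mul x y _ _ hx hy =>
    obtain ⟨s₁, n₁, h₁, rfl⟩ := hx
    obtain ⟨s₂, n₂, h₂, rfl⟩ := hy
    exact h₁.combine h₂ (.inr rfl)

lemma mem_pairSubring_of_isStep [CharZero K] {ι : Type*} {a z : ι → K} {e f h : K[T;T⁻¹]}
    (he : ∀ i, IsNatConst i → ¬ IsUnit (e - i)) {n : ℕ}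
    (hstep : ∀ i : ℕ, i ≤ n → IsStep (fun k => C (a k)) (fun k => C (z k)) e f h i)
    {u v : K} (hu : HasValue e f n (C u)) (hv : HasValue e h n (C v)) :
    (u, v) ∈ pairSubring a z := by
  suffices H : ∀ i ≤ n, ∀ u v, HasValue e f (i : K[T;T⁻¹]) (C u) →
      HasValue e h (i : K[T;T⁻¹]) (C v) → (u, v) ∈ pairSubring a z from H n le_rfl u v hu hv
  clear hu hv u v
  intro i
  induction i using Nat.strong_induction_on with
  | _ i ih =>
  intro hi u v hu hv
  obtain ⟨u', v', hu', hv', hstep⟩ := hstep i hi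
  obtain rfl := hu.unique (he i (isNatConst_natCast i)) hu'
  obtain rfl := hv.unique (he i (isNatConst_natCast i)) hv'
  rcases hstep with ⟨h₁, h₂⟩ | ⟨k, h₁, h₂⟩ |
    ⟨j, l, hj, hl, hji, hli, u₁, v₁, u₂, v₂, hu₁, hv₁, hu₂, hv₂, hop⟩
  · rw [← map_one C, C_injective_s3.eq_iff] at h₁ h₂
    subst h₁ h₂
    exact one_mem _
  · rw [C_injective_s3.eq_iff] at h₁ h₂
    subst h₁ h₂
    exact Subring.subset_closure ⟨k, rfl⟩
  · obtain ⟨j, rfl⟩ := isNatConst_iff.1 hj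
    obtain ⟨l, rfl⟩ := isNatConst_iff.1 hl
    rw [isNatConst_natCast_sub_one_sub_iff] at hji hli
    obtain ⟨u₁, rfl⟩ := hu₁.exists_C
    obtain ⟨v₁, rfl⟩ := hv₁.exists_C
    obtain ⟨u₂, rfl⟩ := hu₂.exists_C
    obtain ⟨v₂, rfl⟩ := hv₂.exists_C
    have m₁ := ih j hji (by omega) u₁ v₁ hu₁ hv₁
    have m₂ := ih l hli (by omega) u₂ v₂ hu₂ hv₂
    simp only [← map_sub, ← map_mul, C_injective_s3.eq_iff] at hop
    rcases hop with ⟨rfl, rfl⟩ | ⟨rfl, rfl⟩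
    · exact sub_mem m₁ m₂
    · exact mul_mem m₁ m₂

lemma exists_hasValue [CharZero K] (s : ℕ → K) (n : ℕ) :
    ∃ f : K[T;T⁻¹], ∀ i ≤ n, HasValue (T 1 - 1) f (i : K[T;T⁻¹]) (C (s i)) := by
  classical
  let p := Lagrange.interpolate (Finset.range (n + 1)) (fun i : ℕ => (i : K)) s
  refine ⟨Polynomial.toLaurent (p.comp (Polynomial.X - 1)), fun i hi => hasValue_C.2 ?_⟩
  have hp : p.eval (i : K) = s i :=
    Lagrange.eval_interpolate_at_node s Nat.cast_injective.injOn
      (by simpa using Nat.lt_succ_of_le hi)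
  have h := map_dvd Polynomial.toLaurent
    (Polynomial.sub_dvd_eval_sub (Polynomial.X - 1) (Polynomial.C (i : K)) (p.map Polynomial.C))
  simpa [Polynomial.eval_map, Polynomial.comp, hp] using h

lemma not_isUnit_T_sub [CharZero K] (n : ℕ) : ¬ IsUnit (T 1 - 1 - (n : K[T;T⁻¹])) := by
  intro h
  have := h.map (eval₂ (RingHom.id K) (Units.mk0 ((n : K) + 1) (Nat.cast_add_one_ne_zero n)))
  simp at this

lemma isDependent_iff [CharZero K] {ι : Type*} (a : ι → K) :
    IsDependent (fun k => (C (a k) : K[T;T⁻¹])) ↔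
      ∃ (z : ι → K) (w : K), w ≠ 0 ∧ (0, w) ∈ pairSubring a z := by
  constructor
  · rintro ⟨e, he, z, hz, f, h, n, w, hn, hf, hh, hw, hstep⟩
    obtain ⟨n, rfl⟩ := isNatConst_iff.1 hn
    obtain ⟨w, rfl⟩ := hh.exists_C
    choose z hz using fun k => isConst_iff.1 (hz k)
    obtain rfl := funext hz
    refine ⟨z, w, by rintro rfl; simp at hw, mem_pairSubring_of_isStep he (fun i hi => hstep i
      (isNatConst_natCast i) (isNatConst_natCast_sub_iff.2 hi)) (by simpa using hf) hh⟩
  · rintro ⟨z, w, hw, hmem⟩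
    obtain ⟨s, n, hs, hsn⟩ := exists_isComputation_of_mem_closure hmem
    obtain ⟨f, hf⟩ := exists_hasValue (fun i => (s i).1) n
    obtain ⟨h, hh⟩ := exists_hasValue (fun i => (s i).2) n
    refine ⟨T 1 - 1, fun i hi => ?_, fun k => C (z k), fun k => isConst_C _, f, h, n, C w,
      isNatConst_natCast n, ?_, ?_, by simpa using hw, fun i hi hin => ?_⟩
    · obtain ⟨i, rfl⟩ := isNatConst_iff.1 hi
      exact not_isUnit_T_sub i
    · simpa [hsn] using hf n le_rfl
    · simpa [hsn] using hh n le_rfl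
    · obtain ⟨i, rfl⟩ := isNatConst_iff.1 hi
      rw [isNatConst_natCast_sub_iff] at hin
      refine ⟨_, _, hf i hin, hh i hin, ?_⟩
      refine (hs i hin).imp (fun h => by simp [h]) (.imp ?_ ?_)
      · rintro ⟨k, hk⟩
        exact ⟨k, by simp [← hk]⟩
      · rintro ⟨j, hj, l, hl, hop⟩
        refine ⟨j, l, isNatConst_natCast j, isNatConst_natCast l,
          isNatConst_natCast_sub_one_sub_iff.2 hj, isNatConst_natCast_sub_one_sub_iff.2 hl,
          _, _, _, _, hf j (by omega), hh j (by omega), hf l (by omega), hh l (by omega), ?_⟩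
        exact hop.imp (fun h => by simp [h]) (fun h => by simp [h])

lemma algebraicIndependent_int_iff_rat [CharZero K] {ι : Type*} {a : ι → K} :
    AlgebraicIndependent ℤ a ↔ AlgebraicIndependent ℚ a :=
  have : Algebra.IsAlgebraic ℤ ℚ := IsLocalization.isAlgebraic ℚ (nonZeroDivisors ℤ)
  ⟨fun h => h.extendScalars ℚ, fun h => h.restrictScalars Int.cast_injective⟩

lemma isDependent_iff_not_algebraicIndependent [CharZero K] {ι : Type*} (a : ι → K) :
    IsDependent (fun k => (C (a k) : K[T;T⁻¹])) ↔ ¬ AlgebraicIndependent ℚ a := by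
  rw [isDependent_iff, ← algebraicIndependent_int_iff_rat, algebraicIndependent_iff]
  push Not
  simp only [mem_pairSubring_iff]
  constructor
  · rintro ⟨z, w, hw, p, hp, rfl⟩
    exact ⟨p, hp, by rintro rfl; simp at hw⟩
  · rintro ⟨p, hp, hp₀⟩
    have hmap : MvPolynomial.map (Int.castRingHom K) p ≠ 0 := fun h =>
      hp₀ (MvPolynomial.map_injective _ Int.cast_injective (by rw [h, map_zero]))
    obtain ⟨z, hz⟩ : ∃ z, MvPolynomial.eval z (MvPolynomial.map (Int.castRingHom K) p) ≠ 0 := by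
      by_contra! h
      exact hmap (MvPolynomial.funext fun z => by rw [h z, map_zero])
    refine ⟨z, _, ?_, p, hp, rfl⟩
    rwa [MvPolynomial.eval_map] at hz

lemma exists_not_isDependent_iff [CharZero K] {ι : Type*} :
    (∃ a : ι → K[T;T⁻¹], (∀ k, IsConst (a k)) ∧ ¬ IsDependent a) ↔
      ∃ a : ι → K, AlgebraicIndependent ℚ a := by
  constructor
  · rintro ⟨a, ha, hdep⟩
    choose b hb using fun k => isConst_iff.1 (ha k)
    obtain rfl := funext hb
    exact ⟨b, by simpa [isDependent_iff_not_algebraicIndependent] using hdep⟩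
  · rintro ⟨a, ha⟩
    exact ⟨fun k => C (a k), fun k => isConst_C _, by
      simpa [isDependent_iff_not_algebraicIndependent] using ha⟩

end LaurentPolynomial

lemma natCast_le_trdegQ_iff {K : Type*} [Field K] [CharZero K] (n : ℕ) :
    (n : Cardinal) ≤ trdegQ K ↔ ∃ a : Fin n → K, AlgebraicIndependent ℚ a := by
  constructor
  · intro h
    rcases n with _ | n
    · exact ⟨Fin.elim0, algebraicIndependent_empty_type_iff.2
        (FaithfulSMul.algebraMap_injective ℚ K)⟩
    · have hlt : (n : Cardinal) < trdegQ K := lt_of_lt_of_le (by exact_mod_cast n.lt_succ_self) h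
      obtain ⟨⟨s, hs⟩, hns⟩ := exists_lt_of_lt_ciSup' hlt
      have hle : Cardinal.lift.{_, 0} #(Fin (n + 1)) ≤ Cardinal.lift.{0, _} #s := by
        simpa using Order.succ_le_of_lt hns
      obtain ⟨f⟩ := Cardinal.lift_mk_le'.1 hle
      exact ⟨fun i => f i, hs.comp f f.injective⟩
  · rintro ⟨a, ha⟩
    refine le_trans ?_ (le_ciSup (f := fun s : {s : Set K // AlgebraicIndependent ℚ
      ((↑) : s → K)} => #s.1) Cardinal.bddAbove_of_small ⟨Set.range a, ha.coe_range⟩)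
    simpa using (Cardinal.mk_range_eq_of_injective ha.injective).ge

lemma Cardinal.eq_or_aleph0_le_of_forall_natCast_le_iff {κ μ : Cardinal.{u}}
    (h : ∀ n : ℕ, (n : Cardinal) ≤ κ ↔ (n : Cardinal) ≤ μ) :
    (ℵ₀ ≤ κ ∧ ℵ₀ ≤ μ) ∨ (κ < ℵ₀ ∧ μ < ℵ₀ ∧ κ = μ) := by
  rcases le_or_gt ℵ₀ κ with hκ | hκ
  · exact .inl ⟨hκ, aleph0_le.2 fun n => (h n).1 (natCast_lt_aleph0.le.trans hκ)⟩
  · rcases le_or_gt ℵ₀ μ with hμ | hμ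
    · exact absurd (aleph0_le.2 fun n => (h n).2 (natCast_lt_aleph0.le.trans hμ)) hκ.not_ge
    · obtain ⟨m, rfl⟩ := lt_aleph0.1 hκ
      obtain ⟨n, rfl⟩ := lt_aleph0.1 hμ
      exact .inr ⟨hκ, hμ, le_antisymm ((h m).1 le_rfl) ((h n).2 le_rfl)⟩

/-- For infinite fields `K₁`, `K₂` of characteristic zero, if the Laurent polynomial
rings `K₁[t,t⁻¹]` and `K₂[t,t⁻¹]` are elementarily equivalent as rings, then the
transcendence degrees of `K₁` and `K₂` over `ℚ` are either both infinite, or both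
finite and equal. -/
theorem laurent_elementarilyEquivalent_implies_trdeg
    (K₁ K₂ : Type u) [Field K₁] [Field K₂] [Infinite K₁] [Infinite K₂]
    [CharZero K₁] [CharZero K₂] :
    letI := compatibleRingOfRing K₁[T;T⁻¹]
    letI := compatibleRingOfRing K₂[T;T⁻¹]
    (K₁[T;T⁻¹] ≅[Language.ring] K₂[T;T⁻¹]) →
      ((ℵ₀ ≤ trdegQ K₁ ∧ ℵ₀ ≤ trdegQ K₂) ∨
        (trdegQ K₁ < ℵ₀ ∧ trdegQ K₂ < ℵ₀ ∧ trdegQ K₁ = trdegQ K₂)) := by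
  let _ := compatibleRingOfRing K₁[T;T⁻¹]
  let _ := compatibleRingOfRing K₂[T;T⁻¹]
  intro h
  refine Cardinal.eq_or_aleph0_le_of_forall_natCast_le_iff fun n => ?_
  rw [natCast_le_trdegQ_iff, natCast_le_trdegQ_iff, ← exists_not_isDependent_iff,
    ← exists_not_isDependent_iff]
  exact h.exists_not_isDependent_iff n
end
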